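/- Let r be a power of p and m = (m_j)_{j≥0} an integer sequence with m_0 = 1 and m_j ≥ 2 for all j ≥ 1. Then for every integer j ≥ 0, r_{j+1}²/r_j − 1 ≤ w_{r_j}*(ξ(r,m)) ≤ r_j r_{j+1}² r_{j+p}² / (r_{j+1}² − r_j²) − 1. -/

import Mathlib

open Polynomial Filter Set
open scoped Classical

noncomputable section

namespace OotoT

variable (Fq : Type) [Field Fq]

/-- We model the field `F_q((T⁻¹))` of Laurent series in `T⁻¹` as `LaurentSeries Fq`,
whose canonical variable `u` plays the role of `T⁻¹`.  Thus `T` itself is `u⁻¹`. -/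
def Tel : LaurentSeries Fq := (HahnSeries.single (1 : ℤ) (1 : Fq))⁻¹

/-- The canonical ring embedding `F_q[T] → F_q((T⁻¹))`, sending `T ↦ u⁻¹`. -/
def ringHomT : Polynomial Fq →+* LaurentSeries Fq :=
  Polynomial.eval₂RingHom (HahnSeries.C : Fq →+* LaurentSeries Fq) (Tel Fq)

/-- The absolute value on `F_q((T⁻¹))`: `|0| = 0` and `|ξ| = q^{-N}` where
`ξ = Σ_{n ≥ N} a_n T^{-n}` with `a_N ≠ 0`; in our model `N` is the order of `ξ`
as a Hahn series in `u = T⁻¹`. -/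
def absL (q : ℕ) (ξ : LaurentSeries Fq) : ℝ :=
  if ξ = 0 then 0 else (q : ℝ) ^ (-ξ.order)

/-- Evaluation of a polynomial `P(X) ∈ (F_q[T])[X]` at `ξ ∈ F_q((T⁻¹))`. -/
def evalP (ξ : LaurentSeries Fq) (P : Polynomial (Polynomial Fq)) : LaurentSeries Fq :=
  Polynomial.eval₂ (ringHomT Fq) ξ P

/-- The height of `P(X) ∈ (F_q[T])[X]`: the maximum of the absolute values of its
coefficients.  A nonzero `c ∈ F_q[T]` has `|c| = q^{deg c}`, so for `P ≠ 0` the height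
is `q` raised to the maximal degree of a (nonzero) coefficient of `P`. -/
def heightP (q : ℕ) (P : Polynomial (Polynomial Fq)) : ℝ :=
  if P = 0 then 0 else (q : ℝ) ^ (P.support.sup fun i => (P.coeff i).natDegree)

/-- `w_n(ξ)`: the supremum (in the extended reals) of the real numbers `w` such that
`0 < |P(ξ)| ≤ H(P)^{-w}` for infinitely many `P(X) ∈ (F_q[T])[X]` of degree at most `n`. -/
def wn (q : ℕ) (n : ℕ) (ξ : LaurentSeries Fq) : EReal :=
  sSup ((fun w : ℝ => (w : EReal)) ''
    {w : ℝ | {P : Polynomial (Polynomial Fq) | P.natDegree ≤ n ∧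
      0 < absL Fq q (evalP Fq ξ P) ∧
      absL Fq q (evalP Fq ξ P) ≤ heightP Fq q P ^ (-w)}.Infinite})

/-- `w(ξ) = limsup_{n→∞} w_n(ξ)/n`. -/
def wB (q : ℕ) (ξ : LaurentSeries Fq) : EReal :=
  Filter.limsup (fun n : ℕ => wn Fq q n ξ / (n : EReal)) Filter.atTop

/-- `ξ` is an `A`-number if `w(ξ) = 0`. -/
def IsANumber (q : ℕ) (ξ : LaurentSeries Fq) : Prop := wB Fq q ξ = 0

/-- `ξ` is an `S`-number if `0 < w(ξ) < +∞`. -/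
def IsSNumber (q : ℕ) (ξ : LaurentSeries Fq) : Prop := 0 < wB Fq q ξ ∧ wB Fq q ξ < ⊤

/-- `ξ` is a `T`-number if `w(ξ) = +∞` and `w_n(ξ) < +∞` for all `n ≥ 1`. -/
def IsTNumber (q : ℕ) (ξ : LaurentSeries Fq) : Prop :=
  wB Fq q ξ = ⊤ ∧ ∀ n : ℕ, 1 ≤ n → wn Fq q n ξ < ⊤

/-- `ξ` is a `U`-number if `w(ξ) = +∞` and `w_n(ξ) = +∞` for some `n ≥ 1`. -/
def IsUNumber (q : ℕ) (ξ : LaurentSeries Fq) : Prop :=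
  wB Fq q ξ = ⊤ ∧ ∃ n : ℕ, 1 ≤ n ∧ wn Fq q n ξ = ⊤

/-- The type `t(ξ) = limsup_{n→∞} (log w_n(ξ))/(log n)` of a `T`-number (as an
extended real; for a `T`-number each `w_n(ξ)` is a finite real, recovered by `toReal`). -/
def typeT (q : ℕ) (ξ : LaurentSeries Fq) : EReal :=
  Filter.limsup
    (fun n : ℕ => ((Real.log (wn Fq q n ξ).toReal / Real.log n : ℝ) : EReal)) Filter.atTop

/-! ### The algebraic closure side -/

/-- The algebraic closure of `F_q((T⁻¹))`. -/
abbrev AC := AlgebraicClosure (LaurentSeries Fq)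

/-- The canonical embedding of `F_q((T⁻¹))` into its algebraic closure. -/
def iota : LaurentSeries Fq →+* AC Fq := algebraMap _ _

/-- The embedding `F_q[T] → AC`. -/
def ringHomTC : Polynomial Fq →+* AC Fq := (iota Fq).comp (ringHomT Fq)

/-- Evaluation of `P(X) ∈ (F_q[T])[X]` at an element of the algebraic closure. -/
def evalPC (α : AC Fq) (P : Polynomial (Polynomial Fq)) : AC Fq :=
  Polynomial.eval₂ (ringHomTC Fq) α P

/-- `P ∈ (F_q[T])[X]` is *the* minimal polynomial of `α`: it is non-constant, irreducible,
primitive, its leading coefficient is monic (in `T`), and `P(α) = 0`.  For `α` algebraic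
over `F_q(T)` such a polynomial exists and is unique. -/
def IsMinPolyOf (α : AC Fq) (P : Polynomial (Polynomial Fq)) : Prop :=
  0 < P.natDegree ∧ Irreducible P ∧ P.IsPrimitive ∧ P.leadingCoeff.Monic ∧ evalPC Fq α P = 0

/-- `α` is algebraic over `F_q(T)`. -/
def IsAlgT (α : AC Fq) : Prop := ∃ P, IsMinPolyOf Fq α P

/-- The degree of an algebraic `α`: the degree of its minimal polynomial. -/
def degT (α : AC Fq) : ℕ := if h : IsAlgT Fq α then h.choose.natDegree else 0

/-- The height of an algebraic `α`: the height of its minimal polynomial. -/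
def heightT (q : ℕ) (α : AC Fq) : ℝ := if h : IsAlgT Fq α then heightP Fq q h.choose else 0

/-- The unique extension of the absolute value to the algebraic closure of `F_q((T⁻¹))`,
given by the standard formula `|x| = |N_{K(x)/K}(x)|^{1/[K(x):K]}`, i.e.
`|x| = |c₀|^{1/d}` where `c₀` is the constant coefficient and `d` the degree of the
minimal polynomial of `x` over `K = F_q((T⁻¹))`. -/
def absC (q : ℕ) (x : AC Fq) : ℝ :=
  absL Fq q ((minpoly (LaurentSeries Fq) x).coeff 0) ^
    (((minpoly (LaurentSeries Fq) x).natDegree : ℝ)⁻¹)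

/-- `w_n^*(ξ)`: the supremum (in the extended reals) of the real numbers `w` such that
`0 < |ξ - α| ≤ H(α)^{-w-1}` for infinitely many `α` algebraic over `F_q(T)` of degree
at most `n`. -/
def wnStar (q : ℕ) (n : ℕ) (ξ : LaurentSeries Fq) : EReal :=
  sSup ((fun w : ℝ => (w : EReal)) ''
    {w : ℝ | {α : AC Fq | IsAlgT Fq α ∧ degT Fq α ≤ n ∧
      0 < absC Fq q (iota Fq ξ - α) ∧
      absC Fq q (iota Fq ξ - α) ≤ heightT Fq q α ^ (-w - 1)}.Infinite})

/-- `w^*(ξ) = limsup_{n→∞} w_n^*(ξ)/n`. -/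
def wBStar (q : ℕ) (ξ : LaurentSeries Fq) : EReal :=
  Filter.limsup (fun n : ℕ => wnStar Fq q n ξ / (n : EReal)) Filter.atTop

/-- `ξ` is an `A*`-number if `w^*(ξ) = 0`. -/
def IsAStarNumber (q : ℕ) (ξ : LaurentSeries Fq) : Prop := wBStar Fq q ξ = 0

/-- `ξ` is a `T*`-number if `w^*(ξ) = +∞` and `w_n^*(ξ) < +∞` for all `n ≥ 1`. -/
def IsTStarNumber (q : ℕ) (ξ : LaurentSeries Fq) : Prop :=
  wBStar Fq q ξ = ⊤ ∧ ∀ n : ℕ, 1 ≤ n → wnStar Fq q n ξ < ⊤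

/-- The `*`-type `t^*(ξ) = limsup_{n→∞} (log w_n^*(ξ))/(log n)` of a `T*`-number. -/
def typeTStar (q : ℕ) (ξ : LaurentSeries Fq) : EReal :=
  Filter.limsup
    (fun n : ℕ => ((Real.log (wnStar Fq q n ξ).toReal / Real.log n : ℝ) : EReal)) Filter.atTop

/-! ### The Laurent series `ξ(r, m)` -/

/-- `r_j = r^{m_0 m_1 ⋯ m_j}`. -/
def rr (r : ℕ) (m : ℕ → ℕ) (j : ℕ) : ℕ := r ^ (∏ i ∈ Finset.range (j + 1), m i)

/-- `α_j(r, m) = Σ_{n=1}^∞ T^{-r_j^n}`, i.e. the power series in `u = T⁻¹` whose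
`k`-th coefficient is `1` exactly when `k = r_j^n` for some `n ≥ 1`. -/
def alphaJ (r : ℕ) (m : ℕ → ℕ) (j : ℕ) : LaurentSeries Fq :=
  HahnSeries.ofPowerSeries ℤ Fq (PowerSeries.mk fun k =>
    if ∃ n : ℕ, 1 ≤ n ∧ k = rr r m j ^ n then 1 else 0)

/-- `ξ_a(r, m) = Σ_{j=0}^∞ a_j α_j(r, m)`, described coefficientwise: the coefficient of
`T^{-k}` is the (finite) sum over `j` of `a_j` times the coefficient of `T^{-k}` in
`α_j(r, m)`. -/
def xiA (r : ℕ) (m : ℕ → ℕ) (a : ℕ → ℕ) : LaurentSeries Fq :=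
  HahnSeries.ofPowerSeries ℤ Fq (PowerSeries.mk fun k =>
    ∑ᶠ j : ℕ, (a j : Fq) * (if ∃ n : ℕ, 1 ≤ n ∧ k = rr r m j ^ n then 1 else 0))

/-- `ξ(r, m) = Σ_{j=0}^∞ α_j(r, m)`. -/
def xi (r : ℕ) (m : ℕ → ℕ) : LaurentSeries Fq := xiA Fq r m fun _ => 1

/-! ### Algebraicity and algebraic dependence over `F_q(T)` for Laurent series -/

/-- `ξ ∈ F_q((T⁻¹))` is algebraic over `F_q(T)`. -/
def IsAlgLS (ξ : LaurentSeries Fq) : Prop :=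
  ∃ P : Polynomial (Polynomial Fq), P ≠ 0 ∧ evalP Fq ξ P = 0

/-- Evaluation of a two-variable polynomial `F(X, Y) ∈ (F_q[T])[X, Y]` (coded as an
iterated polynomial ring, `T` innermost, then `X`, then `Y`) at `(ξ, η)`. -/
def evalXY (ξ η : LaurentSeries Fq) (F : Polynomial (Polynomial (Polynomial Fq))) :
    LaurentSeries Fq :=
  Polynomial.eval₂ (Polynomial.eval₂RingHom (ringHomT Fq) ξ) η F

/-- `ξ` and `η` are algebraically dependent over `F_q(T)`. -/
def AlgDep (ξ η : LaurentSeries Fq) : Prop :=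
  ∃ F : Polynomial (Polynomial (Polynomial Fq)), F ≠ 0 ∧ evalXY Fq ξ η F = 0

/-- `deg_X` of `F(X, Y) ∈ (F_q[T])[X, Y]` in our encoding. -/
def degX (F : Polynomial (Polynomial (Polynomial Fq))) : ℕ :=
  F.support.sup fun i => (F.coeff i).natDegree

/-- `F(X, Y) ∈ (F_q[T])[X, Y]` is primitive (in `X` and `Y`): no non-unit of `F_q[T]`
divides all of its coefficients. -/
def IsPrimitiveXY (F : Polynomial (Polynomial (Polynomial Fq))) : Prop :=
  ∀ c : Polynomial Fq, (∀ i j : ℕ, c ∣ ((F.coeff i).coeff j)) → IsUnit c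

end OotoT

open OotoT

open scoped NNReal in
/-- The `u`-adic valuation on Laurent series, read with values `q ^ (-order)`. -/
abbrev laurentRankOne (Fq : Type) [Field Fq] (q : ℕ) (hq : 1 < q) :
    Valuation.RankOne (Valued.v : Valuation (LaurentSeries Fq) (WithZero (Multiplicative ℤ))) where
  hom' := (WithZeroMulInt.toNNReal (e := (q : ℝ≥0)) (by positivity)).comp
    MonoidWithZeroHom.ValueGroup₀.embedding
  strictMono' := (WithZeroMulInt.toNNReal_strictMono (by exact_mod_cast hq)).comp
    MonoidWithZeroHom.ValueGroup₀.embedding_strictMono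
  exists_val_nontrivial := by
    obtain ⟨x, hx⟩ := LaurentSeries.valuation_surjective Fq (WithZero.exp (1 : ℤ))
    refine ⟨x, ?_, ?_⟩ <;> rw [hx]
    · simp
    · decide

theorem laurent_valuation_eq_order (Fq : Type) [Field Fq] {x : LaurentSeries Fq} (hx : x ≠ 0) :
    (Valued.v x : WithZero (Multiplicative ℤ)) = WithZero.exp (-x.order) := by
  apply le_antisymm
  · rw [LaurentSeries.valuation_le_iff_coeff_lt_eq_zero]
    intro n hn
    exact HahnSeries.coeff_eq_zero_of_lt_order hn
  · by_contra! h
    have h0 : (Valued.v x : WithZero (Multiplicative ℤ)) ≠ 0 := by simpa using hx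
    have h1 : (Valued.v x : WithZero (Multiplicative ℤ)) ≤ WithZero.exp (-(x.order + 1)) := by
      rw [← WithZero.log_le_iff_le_exp h0]
      rw [← WithZero.log_lt_iff_lt_exp h0] at h
      omega
    rw [LaurentSeries.valuation_le_iff_coeff_lt_eq_zero] at h1
    exact hx (HahnSeries.coeff_order_eq_zero.1 (h1 _ (lt_add_one _)))

theorem laurent_norm_eq_absL (Fq : Type) [Field Fq] (q : ℕ) (hq : 1 < q) (x : LaurentSeries Fq) :
    @Valuation.norm _ _ _ _ Valued.v (laurentRankOne Fq q hq) x = absL Fq q x := by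
  let := laurentRankOne Fq q hq
  unfold absL
  split_ifs with h
  · rw [h, Valuation.norm_def, map_zero, map_zero]; rfl
  · have h0 : (Valued.v x : WithZero (Multiplicative ℤ)) ≠ 0 := by simpa using h
    rw [Valuation.norm_def]
    have hq0 : (q : NNReal) ≠ 0 := by positivity
    have : Valuation.RankOne.hom
        (Valued.v : Valuation (LaurentSeries Fq) (WithZero (Multiplicative ℤ)))
        (Valued.v.restrict x) = WithZeroMulInt.toNNReal hq0
          (Valued.v x) := by
      change WithZeroMulInt.toNNReal hq0 (MonoidWithZeroHom.ValueGroup₀.embedding _) = _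
      congr 1
      simp
    rw [this, laurent_valuation_eq_order Fq h, WithZeroMulInt.toNNReal_neg_apply _ (by simp)]
    rw [NNReal.coe_zpow]
    rfl

/-- `absC` is a non-archimedean absolute value on the algebraic closure, extending `absL`. -/
theorem exists_absoluteValue_eq_absC (Fq : Type) [Field Fq] (q : ℕ) (hq : 1 < q) :
    ∃ V : AbsoluteValue (AC Fq) ℝ, IsNonarchimedean V ∧ (∀ x, V (iota Fq x) = absL Fq q x) ∧
      ∀ x, absC Fq q x = V x := by
  let := laurentRankOne Fq q hq
  let : NontriviallyNormedField (LaurentSeries Fq) :=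
    Valued.toNontriviallyNormedField _ (WithZero (Multiplicative ℤ))
  have : IsUltrametricDist (LaurentSeries Fq) :=
    Valued.instIsUltrametricDist _ (WithZero (Multiplicative ℤ))
  have : CompleteSpace (LaurentSeries Fq) := LaurentSeries.instLaurentSeriesComplete
  have hnorm : ∀ x : LaurentSeries Fq, ‖x‖ = absL Fq q x := laurent_norm_eq_absL Fq q hq
  let W := spectralMulAlgNorm (LaurentSeries Fq) (AC Fq)
  have hext : ∀ x, W (iota Fq x) = absL Fq q x := fun x => by
    rw [← hnorm]; exact spectralNorm_extends x
  let V : AbsoluteValue (AC Fq) ℝ :=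
    { toFun := W
      map_mul' := map_mul W
      nonneg' := fun x => apply_nonneg W x
      eq_zero' := fun x => map_eq_zero_iff_eq_zero W
      add_le' := map_add_le_add W }
  refine ⟨V, ?_, hext, fun x => ?_⟩
  · exact isNonarchimedean_spectralNorm
  · set P := minpoly (LaurentSeries Fq) x with hP
    have hint : IsIntegral (LaurentSeries Fq) x := Algebra.IsIntegral.isIntegral x
    have hdeg : 0 < P.natDegree := minpoly.natDegree_pos hint
    have hmon : P.Monic := minpoly.monic hint
    have hsplit : (P.map (iota Fq)).Splits := IsAlgClosed.splits _
    have hc : iota Fq (P.coeff 0) = (-1) ^ P.natDegree * (P.map (iota Fq)).roots.prod := by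
      have := hsplit.coeff_zero_eq_leadingCoeff_mul_prod_roots
      rw [(hmon.map _).leadingCoeff, coeff_map, natDegree_map] at this
      simpa using this
    have hroots : ∀ y ∈ (P.map (iota Fq)).roots, V y = V x := by
      intro y hy
      have hy' : aeval y P = 0 := by
        have := (mem_roots'.1 hy).2
        rwa [IsRoot, eval_map] at this
      have : minpoly (LaurentSeries Fq) y = P :=
        (minpoly.eq_of_irreducible_of_monic (minpoly.irreducible hint) hy' hmon).symm
      change spectralNorm _ _ _ = spectralNorm _ _ _
      rw [spectralNorm, spectralNorm, this]
    have hcard : (P.map (iota Fq)).roots.card = P.natDegree := by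
      rw [← hsplit.natDegree_eq_card_roots, natDegree_map]
    have hv : absL Fq q (P.coeff 0) = V x ^ P.natDegree := by
      rw [← hext]
      change V _ = _
      rw [hc, map_mul, map_pow, map_neg_eq_map, map_one, one_pow, one_mul, map_multiset_prod,
        ← hcard]
      rw [Multiset.map_congr rfl hroots, Multiset.map_const', Multiset.prod_replicate]
    rw [absC, ← hP, hv, ← Real.rpow_natCast, ← Real.rpow_mul (V.nonneg x), mul_inv_cancel₀,
      Real.rpow_one]
    positivity

section Liouville

variable {R L : Type*} [CommRing R] [IsDomain R] [Field L]

/-- Gauss's lemma: a primitive irreducible polynomial divides every polynomial with which it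
shares a root. -/
theorem Irreducible.dvd_of_eval₂_eq_zero [NormalizedGCDMonoid R] {φ : R →+* L}
    (hφ : Function.Injective φ) {P F : R[X]} (hP : Irreducible P) (hprim : P.IsPrimitive) {x : L}
    (hPx : P.eval₂ φ x = 0) (hFx : F.eval₂ φ x = 0) : P ∣ F := by
  let K := FractionRing R
  let ψ : K →+* L := IsFractionRing.lift (g := φ) hφ
  have hψ : ψ.comp (algebraMap R K) = φ := by
    ext r; exact IsFractionRing.lift_algebraMap hφ r
  have hirr : Irreducible (P.map (algebraMap R K)) :=
    hprim.irreducible_iff_irreducible_map_fraction_map.1 hP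
  have hdvd : P.map (algebraMap R K) ∣ F.map (algebraMap R K) := by
    by_contra h
    obtain ⟨u, v, huv⟩ := (EuclideanDomain.dvd_or_coprime _ _ hirr).resolve_left h
    have := congrArg (eval₂ ψ x) huv
    rw [eval₂_add, eval₂_mul, eval₂_mul, eval₂_map, eval₂_map, hψ, hPx, hFx] at this
    simp at this
  exact (hprim.dvd_iff_fraction_map_dvd_fraction_map K).2 hdvd

theorem max_one_le_gaussNorm_X_sub_C (V : AbsoluteValue L ℝ) (a : L) :
    max 1 (V a) ≤ (X - C a).gaussNorm V 1 := by
  apply max_le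
  · have := (X - C a).le_gaussNorm V zero_le_one 1
    rw [coeff_sub, coeff_X_one, coeff_C_succ, sub_zero, map_one, one_pow, mul_one] at this
    exact this
  · have := (X - C a).le_gaussNorm V zero_le_one 0
    rw [coeff_sub, coeff_X_zero, coeff_C_zero, zero_sub, map_neg_eq_map, pow_zero, mul_one] at this
    exact this

theorem prod_max_one_le_gaussNorm {V : AbsoluteValue L ℝ} (hV : IsNonarchimedean V)
    (s : Multiset L) :
    (s.map fun a => max 1 (V a)).prod ≤ ((s.map fun a => X - C a).prod).gaussNorm V 1 := by
  induction s using Multiset.induction_on with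
  | empty => simpa using (1 : L[X]).le_gaussNorm V zero_le_one 0
  | cons a s ih =>
    rw [Multiset.map_cons, Multiset.prod_cons, Multiset.map_cons, Multiset.prod_cons,
      gaussNorm_mul hV one_pos]
    have h0 : 0 ≤ (s.map fun a => max 1 (V a)).prod :=
      Multiset.prod_nonneg fun x hx => by
        obtain ⟨y, -, rfl⟩ := Multiset.mem_map.1 hx
        positivity
    exact mul_le_mul (max_one_le_gaussNorm_X_sub_C V a) ih h0 (gaussNorm_nonneg _ _ zero_le_one)

/-- The easy half of the equality between Gauss norm and Mahler measure. -/
theorem leadingCoeff_mul_prod_max_one_le_gaussNorm {V : AbsoluteValue L ℝ}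
    (hV : IsNonarchimedean V) {f : L[X]} (hf : f.Splits) :
    V f.leadingCoeff * (f.roots.map fun a => max 1 (V a)).prod ≤ f.gaussNorm V 1 := by
  conv_rhs => rw [hf.eq_prod_roots, gaussNorm_mul hV one_pos, gaussNorm_C]
  exact mul_le_mul_of_nonneg_left (prod_max_one_le_gaussNorm hV _) (V.nonneg _)

theorem map_eval_le_gaussNorm_mul {V : AbsoluteValue L ℝ} (hV : IsNonarchimedean V) {g : L[X]}
    {n : ℕ} (hg : g.natDegree ≤ n) (a : L) :
    V (g.eval a) ≤ g.gaussNorm V 1 * max 1 (V a) ^ n := by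
  rw [eval_eq_sum_range]
  obtain ⟨i, hi, hle⟩ := hV.finset_image_add_of_nonempty (fun i : ℕ => g.coeff i * a ^ i)
    (Finset.nonempty_range_add_one (n := g.natDegree))
  have hi' : i ≤ n := by
    rw [Finset.mem_range] at hi
    omega
  refine hle.trans ?_
  rw [map_mul, map_pow]
  have h1 : V (g.coeff i) ≤ g.gaussNorm V 1 := by simpa using g.le_gaussNorm V zero_le_one i
  have h2 : V a ^ i ≤ max 1 (V a) ^ n :=
    (pow_le_pow_left₀ (V.nonneg a) (le_max_right _ _) i).trans
      (pow_le_pow_right₀ (le_max_left _ _) hi')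
  exact mul_le_mul h1 h2 (pow_nonneg (V.nonneg _) _) (gaussNorm_nonneg _ _ zero_le_one)

/-- Liouville's inequality for a non-archimedean absolute value that is at least `1` on the
nonzero elements of the base ring. -/
theorem one_le_map_eval_mul_gaussNorm_pow [IsAlgClosed L] [NormalizedGCDMonoid R]
    {V : AbsoluteValue L ℝ} (hV : IsNonarchimedean V) {φ : R →+* L}
    (hφ : ∀ c, c ≠ 0 → 1 ≤ V (φ c)) {P F : R[X]} (hP : Irreducible P) (hprim : P.IsPrimitive)
    {x : L} (hPx : P.eval₂ φ x = 0) (hFx : F.eval₂ φ x ≠ 0) {n : ℕ} (hn : F.natDegree ≤ n) :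
    1 ≤ V (F.eval₂ φ x) * (F.map φ).gaussNorm V 1 ^ (P.natDegree - 1) *
      (P.map φ).gaussNorm V 1 ^ n := by
  have hinj : Function.Injective φ := by
    refine (injective_iff_map_eq_zero φ).2 fun c hc => ?_
    by_contra h
    have := hφ c h
    rw [hc, map_zero] at this
    linarith
  have hP0 : P.map φ ≠ 0 := (Polynomial.map_ne_zero_iff hinj).2 hP.ne_zero
  have hsplit : (P.map φ).Splits := IsAlgClosed.splits _
  have hres := resultant_eq_prod_eval (P.map φ) (F.map φ) n (natDegree_map_le.trans hn) hsplit
  rw [natDegree_map_eq_of_injective hinj, resultant_map_map] at hres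
  have hne : ∀ y ∈ (P.map φ).roots, (F.map φ).eval y ≠ 0 := by
    intro y hy h0
    have hy' : P.eval₂ φ y = 0 := by
      have := (mem_roots'.1 hy).2
      rwa [IsRoot, eval_map] at this
    rw [eval_map] at h0
    obtain ⟨g, rfl⟩ := hP.dvd_of_eval₂_eq_zero hinj hprim hy' h0
    rw [eval₂_mul, hPx, zero_mul] at hFx
    exact hFx rfl
  have hxroot : x ∈ (P.map φ).roots := by
    rw [mem_roots hP0, IsRoot, eval_map, hPx]
  obtain ⟨s, hs⟩ := Multiset.exists_cons_of_mem hxroot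
  have hscard : s.card = P.natDegree - 1 := by
    have := hsplit.natDegree_eq_card_roots
    rw [natDegree_map_eq_of_injective hinj, hs, Multiset.card_cons] at this
    omega
  have hres0 : resultant P F P.natDegree n ≠ 0 := by
    intro h
    rw [h, map_zero] at hres
    rcases mul_eq_zero.1 hres.symm with h | h
    · exact hP0 (leadingCoeff_eq_zero.1 (eq_zero_of_pow_eq_zero h))
    · obtain ⟨y, hy, hy0⟩ := Multiset.mem_map.1 (Multiset.prod_eq_zero_iff.1 h)
      exact hne y hy hy0
  have h1 := hφ _ hres0
  rw [hres, map_mul, map_pow, hs, Multiset.map_cons, Multiset.prod_cons, map_mul,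
    map_multiset_prod, Multiset.map_map] at h1
  have hG0 : 0 ≤ (F.map φ).gaussNorm V 1 := gaussNorm_nonneg _ _ zero_le_one
  have h2 : (s.map (V ∘ fun y => (F.map φ).eval y)).prod ≤
      (F.map φ).gaussNorm V 1 ^ (P.natDegree - 1) * (s.map fun a => max 1 (V a)).prod ^ n := by
    rw [← hscard, ← Multiset.prod_map_pow, ← Multiset.prod_replicate, ← Multiset.map_const',
      ← Multiset.prod_map_mul]
    exact Multiset.prod_map_le_prod_map₀ _ _ (fun a _ => V.nonneg _)
      fun a _ => map_eval_le_gaussNorm_mul hV (natDegree_map_le.trans hn) a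
  have h3 := leadingCoeff_mul_prod_max_one_le_gaussNorm hV hsplit
  rw [hs, Multiset.map_cons, Multiset.prod_cons] at h3
  set M := (s.map fun a => max 1 (V a)).prod
  have hM : 0 ≤ M := Multiset.prod_nonneg fun x hx => by
    obtain ⟨y, -, rfl⟩ := Multiset.mem_map.1 hx
    positivity
  have h4 : V (P.map φ).leadingCoeff * M ≤ (P.map φ).gaussNorm V 1 := by
    refine le_trans ?_ h3
    gcongr
    exact le_mul_of_one_le_left hM (le_max_left _ _)
  have h5 := pow_le_pow_left₀ (mul_nonneg (V.nonneg _) hM) h4 n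
  rw [eval_map] at h1
  refine h1.trans ?_
  calc _ ≤ V (P.map φ).leadingCoeff ^ n * (V (F.eval₂ φ x) *
        ((F.map φ).gaussNorm V 1 ^ (P.natDegree - 1) * M ^ n)) := by gcongr
    _ = V (F.eval₂ φ x) * (F.map φ).gaussNorm V 1 ^ (P.natDegree - 1) *
        (V (P.map φ).leadingCoeff * M) ^ n := by ring
    _ ≤ _ := by gcongr

end Liouville

section Height

variable {Fq : Type} [Field Fq]

theorem absL_eq_of_coeff {x : LaurentSeries Fq} {N : ℤ} (hN : x.coeff N ≠ 0)
    (hlt : ∀ n < N, x.coeff n = 0) (q : ℕ) : absL Fq q x = (q : ℝ) ^ (-N) := by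
  have hx : x ≠ 0 := fun h => hN (by simp [h])
  have hord : x.order = N := by
    refine le_antisymm (HahnSeries.order_le_of_coeff_ne_zero hN) ?_
    by_contra! h
    exact hx (HahnSeries.coeff_order_eq_zero.1 (hlt _ h))
  rw [absL, if_neg hx, hord]

theorem Tel_pow (n : ℕ) : Tel Fq ^ n = HahnSeries.single (-(n : ℤ)) 1 := by
  rw [Tel, HahnSeries.inv_single, HahnSeries.single_pow]
  simp

theorem ringHomT_monomial (n : ℕ) (a : Fq) :
    ringHomT Fq (monomial n a) = HahnSeries.single (-(n : ℤ)) a := by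
  rw [ringHomT, coe_eval₂RingHom, eval₂_monomial, Tel_pow]
  simp [HahnSeries.C_apply]

theorem ringHomT_X_pow (n : ℕ) : ringHomT Fq (X ^ n) = HahnSeries.single (-(n : ℤ)) 1 := by
  rw [X_pow_eq_monomial, ringHomT_monomial]

theorem coeff_ringHomT (c : Fq[X]) (n : ℤ) :
    (ringHomT Fq c).coeff n = if n ≤ 0 then c.coeff (-n).toNat else 0 := by
  induction c using Polynomial.induction_on' with
  | add f g hf hg =>
    rw [map_add, HahnSeries.coeff_add, hf, hg]
    split_ifs <;> simp
  | monomial k a =>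
    rw [ringHomT_monomial, HahnSeries.coeff_single, coeff_monomial]
    split_ifs <;> first | rfl | omega

theorem absL_ringHomT {c : Fq[X]} (hc : c ≠ 0) (q : ℕ) :
    absL Fq q (ringHomT Fq c) = (q : ℝ) ^ c.natDegree := by
  rw [absL_eq_of_coeff (N := -(c.natDegree : ℤ)), neg_neg, zpow_natCast]
  · rw [coeff_ringHomT]
    simpa using hc
  · intro n hn
    rw [coeff_ringHomT]
    split_ifs
    · exact coeff_eq_zero_of_natDegree_lt (by omega)
    · rfl

/-- The exponent of the height of a polynomial. -/
def logHeight (P : Fq[X][X]) : ℕ := P.support.sup fun i => (P.coeff i).natDegree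

theorem natDegree_coeff_le_logHeight (P : Fq[X][X]) (i : ℕ) :
    (P.coeff i).natDegree ≤ logHeight P := by
  by_cases h : i ∈ P.support
  · exact Finset.le_sup (f := fun i => (P.coeff i).natDegree) h
  · simp [notMem_support_iff.1 h]

theorem heightP_eq {P : Fq[X][X]} (hP : P ≠ 0) (q : ℕ) :
    heightP Fq q P = (q : ℝ) ^ logHeight P := by
  rw [heightP, if_neg hP, logHeight]

variable {q : ℕ} {V : AbsoluteValue (AC Fq) ℝ}

theorem map_ringHomTC (hext : ∀ x, V (iota Fq x) = absL Fq q x) {c : Fq[X]} (hc : c ≠ 0) :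
    V (ringHomTC Fq c) = (q : ℝ) ^ c.natDegree := by
  rw [ringHomTC, RingHom.comp_apply, hext, absL_ringHomT hc]

theorem one_le_map_ringHomTC (hq : 1 < q) (hext : ∀ x, V (iota Fq x) = absL Fq q x) (c : Fq[X])
    (hc : c ≠ 0) : 1 ≤ V (ringHomTC Fq c) := by
  rw [map_ringHomTC hext hc]
  exact one_le_pow₀ (by exact_mod_cast hq.le)

theorem ringHomTC_injective : Function.Injective (ringHomTC Fq) := by
  refine (iota Fq).injective.comp ((injective_iff_map_eq_zero _).2 fun c hc => ?_)
  by_contra h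
  have := absL_ringHomT h 1
  rw [hc] at this
  simp [absL] at this

theorem gaussNorm_map_ringHomTC (hq : 1 < q) (hext : ∀ x, V (iota Fq x) = absL Fq q x)
    {P : Fq[X][X]} (hP : P ≠ 0) :
    (P.map (ringHomTC Fq)).gaussNorm V 1 = (q : ℝ) ^ logHeight P := by
  have hq' : (1 : ℝ) ≤ q := by exact_mod_cast hq.le
  apply le_antisymm
  · obtain ⟨i, hi⟩ := (P.map (ringHomTC Fq)).exists_eq_gaussNorm V 1
    rw [hi, one_pow, mul_one, coeff_map]
    by_cases h0 : P.coeff i = 0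
    · rw [h0, map_zero, map_zero]; positivity
    · rw [map_ringHomTC hext h0]
      exact pow_le_pow_right₀ hq' (natDegree_coeff_le_logHeight P i)
  · obtain ⟨i, hi, hi'⟩ := Finset.exists_mem_eq_sup P.support (by simpa using hP)
      fun i => (P.coeff i).natDegree
    rw [logHeight, hi', ← map_ringHomTC hext (mem_support_iff.1 hi), ← coeff_map]
    simpa using (P.map (ringHomTC Fq)).le_gaussNorm V zero_le_one i

theorem logHeight_le_of_dvd (hq : 1 < q) (hV : IsNonarchimedean V)
    (hext : ∀ x, V (iota Fq x) = absL Fq q x) {P F : Fq[X][X]} (hPF : P ∣ F) (hF : F ≠ 0) :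
    logHeight P ≤ logHeight F := by
  obtain ⟨G, rfl⟩ := hPF
  have hP : P ≠ 0 := left_ne_zero_of_mul hF
  have hG : G ≠ 0 := right_ne_zero_of_mul hF
  have h := gaussNorm_map_ringHomTC hq hext hF
  rw [Polynomial.map_mul, gaussNorm_mul hV one_pos, gaussNorm_map_ringHomTC hq hext hP,
    gaussNorm_map_ringHomTC hq hext hG, ← pow_add] at h
  have := pow_right_injective₀ (by positivity) (by exact_mod_cast hq.ne') h
  omega

theorem isAlgT_of_evalPC_eq_zero {α : AC Fq} {F : Fq[X][X]} (hF : F ≠ 0)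
    (hα : evalPC Fq α F = 0) : IsAlgT Fq α := by
  obtain ⟨P, hP, hPα⟩ : ∃ P : Fq[X][X], Irreducible P ∧ evalPC Fq α P = 0 := by
    obtain ⟨s, hs, hsF⟩ := WfDvdMonoid.exists_factors F hF
    obtain ⟨u, hu⟩ := hsF
    have h0 : (s.map (evalPC Fq α)).prod = 0 := by
      have h1 : evalPC Fq α s.prod * evalPC Fq α u = 0 := by
        rw [← hα, ← hu]
        exact (eval₂_mul _ _).symm
      have h2 : evalPC Fq α u ≠ 0 :=
        (u.isUnit.map (eval₂RingHom (ringHomTC Fq) α)).ne_zero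
      rw [← (mul_eq_zero.1 h1).resolve_right h2]
      exact (map_multiset_prod (eval₂RingHom (ringHomTC Fq) α) s).symm
    obtain ⟨P, hPs, hP0⟩ := Multiset.mem_map.1 (Multiset.prod_eq_zero_iff.1 h0)
    exact ⟨P, hs P hPs, hP0⟩
  have hdeg : 0 < P.natDegree := by
    by_contra! h
    have hC := eq_C_of_natDegree_le_zero h
    rw [hC, evalPC, eval₂_C, map_eq_zero_iff _ ringHomTC_injective] at hPα
    rw [hPα, C_0] at hC
    exact hP.ne_zero hC
  set c : Fq := P.leadingCoeff.leadingCoeff with hc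
  have hc0 : c ≠ 0 := by simpa [hc] using hP.ne_zero
  have hunit : IsUnit (C (C c⁻¹) : Fq[X][X]) :=
    isUnit_C.2 (isUnit_C.2 (inv_ne_zero hc0).isUnit)
  have hirr : Irreducible (C (C c⁻¹) * P) := (irreducible_isUnit_mul hunit).2 hP
  have hdeg' : (C (C c⁻¹) * P).natDegree = P.natDegree :=
    natDegree_C_mul (C_ne_zero.2 (inv_ne_zero hc0))
  refine ⟨C (C c⁻¹) * P, hdeg' ▸ hdeg, hirr, hirr.isPrimitive (hdeg' ▸ hdeg.ne'), ?_, ?_⟩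
  · rw [Monic, leadingCoeff_mul, leadingCoeff_C, leadingCoeff_mul, leadingCoeff_C,
      inv_mul_cancel₀ hc0]
  · rw [evalPC, eval₂_mul]
    rw [evalPC] at hPα
    rw [hPα, mul_zero]

theorem IsMinPolyOf.dvd {α : AC Fq} {P F : Fq[X][X]} (hP : IsMinPolyOf Fq α P)
    (hF : evalPC Fq α F = 0) : P ∣ F :=
  hP.2.1.dvd_of_eval₂_eq_zero ringHomTC_injective hP.2.2.1 hP.2.2.2.2 hF

theorem exists_isMinPolyOf {α : AC Fq} (h : IsAlgT Fq α) (q : ℕ) :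
    ∃ P, IsMinPolyOf Fq α P ∧ degT Fq α = P.natDegree ∧
      heightT Fq q α = (q : ℝ) ^ logHeight P := by
  refine ⟨h.choose, h.choose_spec, by rw [degT, dif_pos h], ?_⟩
  rw [heightT, dif_pos h, heightP_eq h.choose_spec.2.1.ne_zero]

theorem finite_setOf_natDegree_le_logHeight_le [Finite Fq] (n k : ℕ) :
    {P : Fq[X][X] | P.natDegree ≤ n ∧ logHeight P ≤ k}.Finite := by
  refine Set.Finite.of_finite_image (f := fun P (ij : Fin (n + 1) × Fin (k + 1)) =>
    (P.coeff ij.1).coeff ij.2) (Set.toFinite _) ?_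
  rintro P ⟨hP, hP'⟩ Q ⟨hQ, hQ'⟩ h
  ext i l
  by_cases hi : i ≤ n
  · by_cases hl : l ≤ k
    · exact congrFun h (⟨i, by omega⟩, ⟨l, by omega⟩)
    · rw [coeff_eq_zero_of_natDegree_lt, coeff_eq_zero_of_natDegree_lt]
      · have := natDegree_coeff_le_logHeight Q i
        omega
      · have := natDegree_coeff_le_logHeight P i
        omega
  · rw [coeff_eq_zero_of_natDegree_lt (by omega : P.natDegree < i),
      coeff_eq_zero_of_natDegree_lt (by omega : Q.natDegree < i)]

theorem finite_setOf_degree_le_logHeight_le [Finite Fq] (n k : ℕ) :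
    {α : AC Fq | ∃ P, IsMinPolyOf Fq α P ∧ P.natDegree ≤ n ∧ logHeight P ≤ k}.Finite := by
  refine ((finite_setOf_natDegree_le_logHeight_le n k).biUnion (t := fun P =>
    {α : AC Fq | α ∈ (P.map (ringHomTC Fq)).roots}) fun P _ => ?_).subset ?_
  · exact (Multiset.finite_toSet _)
  · rintro α ⟨P, hP, h⟩
    refine Set.mem_biUnion h ?_
    change α ∈ (P.map (ringHomTC Fq)).roots
    rw [mem_roots ((Polynomial.map_ne_zero_iff ringHomTC_injective).2 hP.2.1.ne_zero), IsRoot,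
      eval_map]
    exact hP.2.2.2.2

end Height

section AdditiveEquation

variable {Fq : Type} [Field Fq]

/-- The polynomial `T ^ D * (Y ^ d - Y) - A`. -/
def additivePoly (d D : ℕ) (A : Fq[X]) : Fq[X][X] := C (X ^ D) * (X ^ d - X) - C A

theorem natDegree_additivePoly_le {d : ℕ} (hd : 1 ≤ d) (D : ℕ) (A : Fq[X]) :
    (additivePoly d D A).natDegree ≤ d := by
  rw [additivePoly, natDegree_sub_C]
  refine (natDegree_C_mul_le _ _).trans ((natDegree_sub_le _ _).trans ?_)
  simp [hd]

theorem additivePoly_ne_zero {d : ℕ} (hd : 2 ≤ d) (D : ℕ) (A : Fq[X]) :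
    additivePoly d D A ≠ 0 := by
  intro h
  have h1 : d ≠ 0 := by omega
  have h2 : (1 : ℕ) ≠ d := by omega
  have := congrArg (fun P => P.coeff d) h
  rw [additivePoly] at this
  simp only [coeff_sub, coeff_C_mul, coeff_X_pow_self, coeff_X, coeff_C, if_neg h1, if_neg h2,
    coeff_zero, sub_zero, mul_one] at this
  exact pow_ne_zero D X_ne_zero this

theorem logHeight_additivePoly_le {d D : ℕ} {A : Fq[X]} (hA : A.natDegree ≤ D) :
    logHeight (additivePoly d D A) ≤ D := by
  refine Finset.sup_le fun i _ => ?_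
  rw [additivePoly, coeff_sub, coeff_C_mul, coeff_sub, coeff_X_pow, coeff_X, coeff_C]
  refine (natDegree_sub_le _ _).trans (max_le ?_ ?_)
  · refine natDegree_mul_le.trans ?_
    split_ifs <;> simp
  · split_ifs <;> simp [hA]

variable {p : ℕ} [Fact p.Prime] [CharP Fq p]

theorem evalPC_additivePoly {β : LaurentSeries Fq} {e D : ℕ} {A : Fq[X]}
    (hβ : HahnSeries.single (-(D : ℤ)) 1 * (β ^ p ^ e - β) = ringHomT Fq A) (α : AC Fq) :
    evalPC Fq α (additivePoly (p ^ e) D A) =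
      ringHomTC Fq (X ^ D) * ((α - iota Fq β) ^ p ^ e - (α - iota Fq β)) := by
  have : CharP (LaurentSeries Fq) p :=
    charP_of_injective_algebraMap (algebraMap Fq (LaurentSeries Fq)).injective p
  have : CharP (AC Fq) p := charP_of_injective_algebraMap (iota Fq).injective p
  have hA : ringHomTC Fq A = ringHomTC Fq (X ^ D) * (iota Fq β ^ p ^ e - iota Fq β) := by
    simp only [ringHomTC, RingHom.comp_apply]
    rw [← hβ, ringHomT_X_pow, map_mul, map_sub, map_pow]
  rw [sub_pow_char_pow, evalPC, additivePoly, eval₂_sub, eval₂_mul, eval₂_C, eval₂_C, eval₂_sub,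
    eval₂_X_pow, eval₂_X, hA]
  ring

variable {q : ℕ} {V : AbsoluteValue (AC Fq) ℝ}

theorem isAlgT_and_degree_le_of_additive (hq : 1 < q) (hV : IsNonarchimedean V)
    (hext : ∀ x, V (iota Fq x) = absL Fq q x) {β : LaurentSeries Fq} {e D : ℕ} {A : Fq[X]}
    (he : 0 < e) (hA : A.natDegree ≤ D)
    (hβ : HahnSeries.single (-(D : ℤ)) 1 * (β ^ p ^ e - β) = ringHomT Fq A) :
    IsAlgT Fq (iota Fq β) ∧ ∀ P, IsMinPolyOf Fq (iota Fq β) P →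
      P.natDegree ≤ p ^ e ∧ logHeight P ≤ D := by
  have hd : 2 ≤ p ^ e := Nat.succ_le_of_lt (one_lt_pow₀ (Fact.out : p.Prime).one_lt he.ne')
  have hF := additivePoly_ne_zero hd D A
  have h0 : evalPC Fq (iota Fq β) (additivePoly (p ^ e) D A) = 0 := by
    rw [evalPC_additivePoly hβ, sub_self, zero_pow (by omega), sub_self, mul_zero]
  refine ⟨isAlgT_of_evalPC_eq_zero hF h0, fun P hP => ?_⟩
  have hdvd := _root_.IsMinPolyOf.dvd hP h0
  exact ⟨(natDegree_le_of_dvd hdvd hF).trans (natDegree_additivePoly_le (by omega) _ _),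
    (logHeight_le_of_dvd hq hV hext hdvd hF).trans (logHeight_additivePoly_le hA)⟩

theorem le_map_sub_of_additive (hq : 1 < q) (hV : IsNonarchimedean V)
    (hext : ∀ x, V (iota Fq x) = absL Fq q x) {β : LaurentSeries Fq} {e D : ℕ} {A : Fq[X]}
    (he : 0 < e) (hA : A.natDegree ≤ D)
    (hβ : HahnSeries.single (-(D : ℤ)) 1 * (β ^ p ^ e - β) = ringHomT Fq A)
    {α : AC Fq} {P : Fq[X][X]} (hP : IsMinPolyOf Fq α P) (hdeg : P.natDegree ≤ p ^ e)
    (hne : α ≠ iota Fq β) :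
    1 ≤ V (α - iota Fq β) * (q : ℝ) ^ (p ^ e * logHeight P + p ^ e * D) := by
  have hq1 : (1 : ℝ) ≤ q := by exact_mod_cast hq.le
  have hd : 2 ≤ p ^ e := Nat.succ_le_of_lt (one_lt_pow₀ (Fact.out : p.Prime).one_lt he.ne')
  have hF := additivePoly_ne_zero hd D A
  set δ := α - iota Fq β with hδ
  have hδ0 : δ ≠ 0 := sub_ne_zero.2 hne
  by_cases hδ1 : 1 ≤ V δ
  · exact one_le_mul_of_one_le_of_one_le hδ1 (one_le_pow₀ hq1)
  push Not at hδ1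
  have hpos : 0 < V δ := V.pos hδ0
  have hlt : V (δ ^ p ^ e) < V δ := by
    rw [map_pow]
    exact pow_lt_self_of_lt_one₀ hpos hδ1 (by omega)
  have heval := evalPC_additivePoly hβ α
  rw [← hδ] at heval
  have hFα : evalPC Fq α (additivePoly (p ^ e) D A) ≠ 0 := by
    rw [heval]
    refine mul_ne_zero ?_ (sub_ne_zero.2 fun h => hlt.ne (by rw [h]))
    rw [map_ne_zero_iff _ ringHomTC_injective]
    exact pow_ne_zero _ X_ne_zero
  have hVF : V (evalPC Fq α (additivePoly (p ^ e) D A)) ≤ (q : ℝ) ^ D * V δ := by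
    rw [heval, map_mul, map_ringHomTC hext (pow_ne_zero _ X_ne_zero), natDegree_X_pow]
    gcongr
    have := hV (δ ^ p ^ e) (-δ)
    rw [← sub_eq_add_neg, V.map_neg] at this
    exact this.trans (max_le hlt.le le_rfl)
  have key := one_le_map_eval_mul_gaussNorm_pow hV (one_le_map_ringHomTC hq hext) hP.2.1
    hP.2.2.1 hP.2.2.2.2 hFα (natDegree_additivePoly_le (by omega) _ _)
  rw [gaussNorm_map_ringHomTC hq hext hF, gaussNorm_map_ringHomTC hq hext hP.2.1.ne_zero] at key
  refine key.trans ?_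
  have hlog : (q : ℝ) ^ logHeight (additivePoly (p ^ e) D A) ≤ (q : ℝ) ^ D :=
    pow_le_pow_right₀ hq1 (logHeight_additivePoly_le hA)
  calc _ ≤ (q : ℝ) ^ D * V δ * ((q : ℝ) ^ D) ^ (p ^ e - 1) * ((q : ℝ) ^ logHeight P) ^ p ^ e := by
        have : ((q : ℝ) ^ logHeight (additivePoly (p ^ e) D A)) ^ (P.natDegree - 1) ≤
            ((q : ℝ) ^ D) ^ (p ^ e - 1) :=
          (pow_le_pow_left₀ (by positivity) hlog _).trans
            (pow_le_pow_right₀ (one_le_pow₀ hq1) (by omega))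
        gcongr
        exact hVF
    _ = V δ * ((q : ℝ) ^ D * ((q : ℝ) ^ D) ^ (p ^ e - 1)) * ((q : ℝ) ^ logHeight P) ^ p ^ e := by
        ring
    _ = V δ * (q : ℝ) ^ (p ^ e * logHeight P + p ^ e * D) := by
        rw [← pow_succ', Nat.sub_add_cancel (by omega), ← pow_mul, ← pow_mul, mul_assoc,
          ← pow_add]
        congr 2
        ring

end AdditiveEquation

section NatCoefficients

variable {Fq : Type} [Field Fq] {p : ℕ} [Fact p.Prime] [CharP Fq p]

/-- The Laurent series in `T⁻¹` with natural number coefficients `f`. -/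
def natSeries (Fq : Type) [Field Fq] (f : ℕ → ℕ) : LaurentSeries Fq :=
  HahnSeries.ofPowerSeries ℤ Fq (PowerSeries.mk fun k => (f k : Fq))

theorem coeff_natSeries (f : ℕ → ℕ) (n : ℤ) :
    (natSeries Fq f).coeff n = if n < 0 then 0 else (f n.natAbs : Fq) := by
  rw [natSeries, PowerSeries.coeff_coe, PowerSeries.coeff_mk]

theorem natSeries_pow_char_pow (f : ℕ → ℕ) (e : ℕ) :
    natSeries Fq f ^ p ^ e = natSeries Fq fun k => if p ^ e ∣ k then f (k / p ^ e) else 0 := by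
  have hp : p ≠ 0 := (Fact.out : p.Prime).ne_zero
  have : ExpChar Fq p := ExpChar.prime Fact.out
  rw [natSeries, ← map_pow, natSeries]
  congr 1
  refine (MvPowerSeries.map_iterateFrobenius_expand p hp _ e).symm.trans ?_
  ext k
  rw [PowerSeries.coeff_mk]
  refine (PowerSeries.coeff_map (iterateFrobenius Fq p e) k
    (PowerSeries.expand (p ^ e) (pow_ne_zero e hp) _)).trans ?_
  rw [PowerSeries.coeff_expand, PowerSeries.coeff_mk]
  split_ifs <;> simp

theorem exists_ringHomT_eq_of_eventually {f : ℕ → ℕ} {e D : ℕ}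
    (hf : ∀ k, D < k → (if p ^ e ∣ k then f (k / p ^ e) else 0) = f k) :
    ∃ A : Fq[X], A.natDegree ≤ D ∧
      HahnSeries.single (-(D : ℤ)) 1 * (natSeries Fq f ^ p ^ e - natSeries Fq f) =
        ringHomT Fq A := by
  rw [natSeries_pow_char_pow]
  set g : ℕ → ℕ := fun k => if p ^ e ∣ k then f (k / p ^ e) else 0
  have hA (n : ℕ) : (∑ k ∈ Finset.range (D + 1),
      monomial k ((g (D - k) : Fq) - f (D - k))).coeff n =
      if n ≤ D then (g (D - n) : Fq) - f (D - n) else 0 := by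
    simp only [finsetSum_coeff, coeff_monomial, Finset.sum_ite_eq', Finset.mem_range,
      Nat.lt_succ_iff]
  refine ⟨∑ k ∈ Finset.range (D + 1), monomial k ((g (D - k) : Fq) - f (D - k)), ?_, ?_⟩
  · exact natDegree_le_iff_coeff_eq_zero.2 fun n hn => by rw [hA, if_neg (by omega)]
  · ext n
    rw [HahnSeries.coeff_single_mul, one_mul, HahnSeries.coeff_sub, coeff_natSeries,
      coeff_natSeries, coeff_ringHomT, hA]
    by_cases h1 : n - -(D : ℤ) < 0
    · rw [if_pos h1, if_pos h1, sub_self, if_neg (by omega : ¬ (-n).toNat ≤ D), ite_self]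
    · rw [if_neg h1, if_neg h1]
      by_cases h2 : n ≤ 0
      · rw [if_pos h2, if_pos (by omega), show (n - -(D : ℤ)).natAbs = D - (-n).toNat by omega]
      · rw [if_neg h2, ← hf _ (by omega : D < (n - -(D : ℤ)).natAbs), sub_self]

theorem absL_natSeries_sub {f g : ℕ → ℕ} {K : ℕ} (hlt : ∀ k < K, (f k : Fq) = g k)
    (hK : (f K : Fq) ≠ g K) (q : ℕ) :
    absL Fq q (natSeries Fq f - natSeries Fq g) = (q : ℝ) ^ (-(K : ℤ)) := by
  refine absL_eq_of_coeff ?_ (fun n hn => ?_) q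
  · rw [HahnSeries.coeff_sub, coeff_natSeries, coeff_natSeries, if_neg (by omega),
      if_neg (by omega), Int.natAbs_natCast]
    exact sub_ne_zero.2 hK
  · rw [HahnSeries.coeff_sub, coeff_natSeries, coeff_natSeries]
    split_ifs with h
    · exact sub_self _
    · rw [hlt _ (by omega), sub_self]

end NatCoefficients

section Exponents

variable {r : ℕ} {m : ℕ → ℕ}

theorem rr_eq_rr_pow {i l : ℕ} (h : i ≤ l) :
    rr r m l = rr r m i ^ ∏ x ∈ Finset.Ico (i + 1) (l + 1), m x := by
  rw [rr, rr, ← pow_mul, Finset.prod_range_mul_prod_Ico _ (by omega)]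

theorem lt_rr (hr : 2 ≤ r) (hm0 : m 0 = 1) (hm : ∀ j, 1 ≤ j → 2 ≤ m j) (i : ℕ) :
    i < rr r m i := by
  have h : 2 ^ i ≤ ∏ x ∈ Finset.range (i + 1), m x := by
    rw [Finset.prod_range_succ', hm0, mul_one]
    calc 2 ^ i = ∏ _x ∈ Finset.range i, 2 := by simp
      _ ≤ _ := Finset.prod_le_prod' fun x _ => hm (x + 1) (by omega)
  calc i < 2 ^ i := Nat.lt_two_pow_self
    _ ≤ _ := h
    _ ≤ _ := (Nat.lt_pow_self (by omega)).le

theorem prod_Ico_pos (hm : ∀ j, 1 ≤ j → 2 ≤ m j) (i l : ℕ) :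
    0 < ∏ x ∈ Finset.Ico (i + 1) l, m x := by
  refine Finset.prod_pos fun x hx => ?_
  have := hm x (by rw [Finset.mem_Ico] at hx; omega)
  omega

theorem two_le_rr (hr : 2 ≤ r) (hm0 : m 0 = 1) (hm : ∀ j, 1 ≤ j → 2 ≤ m j) (i : ℕ) :
    2 ≤ rr r m i := by
  rw [rr_eq_rr_pow (Nat.zero_le i)]
  have h0 : rr r m 0 = r := by simp [rr, hm0]
  rw [h0]
  exact hr.trans (Nat.le_self_pow (prod_Ico_pos hm _ _).ne' _)

/-- The number of `i ∈ s` such that `k` is a positive power of `r_i`. -/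
def powerCount (r : ℕ) (m : ℕ → ℕ) (s : Finset ℕ) (k : ℕ) : ℕ :=
  (s.filter fun i => ∃ n, 1 ≤ n ∧ k = rr r m i ^ n).card

theorem xi_eq_natSeries (hr : 2 ≤ r) (hm0 : m 0 = 1) (hm : ∀ j, 1 ≤ j → 2 ≤ m j)
    (Fq : Type) [Field Fq] :
    xi Fq r m = natSeries Fq fun k => powerCount r m (Finset.range k) k := by
  rw [xi, xiA, natSeries]
  congr 2
  ext k
  rw [finsum_eq_sum_of_support_subset (s := Finset.range k)]
  · simp [powerCount]
  · intro i hi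
    simp only [Function.mem_support, ne_eq, Nat.cast_one, one_mul, ite_eq_right_iff,
      one_ne_zero, imp_false, not_not] at hi
    obtain ⟨n, hn, rfl⟩ := hi
    rw [Finset.mem_coe, Finset.mem_range]
    exact (lt_rr hr hm0 hm i).trans_le (Nat.le_self_pow (by omega) _)

theorem powerCount_range_eq (hr : 2 ≤ r) (hm0 : m 0 = 1) (hm : ∀ j, 1 ≤ j → 2 ≤ m j)
    {k B : ℕ} (hB : k ≤ B) :
    powerCount r m (Finset.range k) k = powerCount r m (Finset.range B) k := by
  rw [powerCount, powerCount]
  congr 1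
  ext i
  simp only [Finset.mem_filter, Finset.mem_range, and_congr_left_iff]
  rintro ⟨n, hn, rfl⟩
  have := (lt_rr hr hm0 hm i).trans_le (Nat.le_self_pow (by omega : n ≠ 0) _)
  omega

theorem powerCount_eq_add_Ico (hr : 2 ≤ r) (hm0 : m 0 = 1) (hm : ∀ j, 1 ≤ j → 2 ≤ m j)
    {k j B : ℕ} (hB : k ≤ B) (hj : j ≤ B) :
    powerCount r m (Finset.range k) k =
      powerCount r m (Finset.range j) k + powerCount r m (Finset.Ico j B) k := by
  rw [powerCount_range_eq hr hm0 hm hB, powerCount, powerCount, powerCount,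
    ← Finset.card_union_of_disjoint, ← Finset.filter_union]
  · congr 2
    ext i
    simp
    omega
  · refine Finset.disjoint_filter_filter ?_
    rw [Finset.disjoint_left]
    intro i
    simp
    omega

theorem powerCount_mul_eq (hr : 2 ≤ r) (hm0 : m 0 = 1) (hm : ∀ j, 1 ≤ j → 2 ≤ m j)
    (j : ℕ) {k : ℕ} (hk : rr r m j < k) :
    (if rr r m j ∣ k then powerCount r m (Finset.range (j + 1)) (k / rr r m j) else 0) =
      powerCount r m (Finset.range (j + 1)) k := by
  have hd := two_le_rr hr hm0 hm j
  have hdvd {i n : ℕ} (hi : i < j + 1) (h : k = rr r m i ^ n) :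
      ∃ c, 1 ≤ c ∧ k = rr r m j * rr r m i ^ c := by
    rw [rr_eq_rr_pow (by omega : i ≤ j), h] at hk ⊢
    have := (Nat.pow_lt_pow_iff_right (two_le_rr hr hm0 hm i)).1 hk
    refine ⟨n - ∏ x ∈ Finset.Ico (i + 1) (j + 1), m x, by omega, ?_⟩
    rw [← pow_add]
    congr 1
    omega
  split_ifs with h
  · obtain ⟨l, rfl⟩ := h
    rw [Nat.mul_div_cancel_left _ (by omega), powerCount, powerCount]
    congr 1
    refine Finset.filter_congr fun i hi => ?_
    rw [Finset.mem_range] at hi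
    constructor
    · rintro ⟨n, hn, rfl⟩
      rw [rr_eq_rr_pow (by omega : i ≤ j), ← pow_add]
      exact ⟨_, by omega, rfl⟩
    · rintro ⟨n, hn, h⟩
      obtain ⟨c, hc, h⟩ := hdvd hi h
      exact ⟨c, hc, Nat.eq_of_mul_eq_mul_left (by omega) h⟩
  · symm
    rw [powerCount, Finset.card_eq_zero, Finset.filter_eq_empty_iff]
    rintro i hi ⟨n, hn, hk'⟩
    obtain ⟨c, -, rfl⟩ := hdvd (Finset.mem_range.1 hi) hk'
    exact h (dvd_mul_right _ _)

theorem exists_pow_eq_iff_dvd (hr : 2 ≤ r) (hm0 : m 0 = 1) (hm : ∀ j, 1 ≤ j → 2 ≤ m j)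
    {i l s : ℕ} (hil : i ≤ l) (hs : 0 < s) :
    (∃ n, 1 ≤ n ∧ rr r m i ^ s = rr r m l ^ n) ↔ ∏ x ∈ Finset.Ico (i + 1) (l + 1), m x ∣ s := by
  rw [rr_eq_rr_pow hil]
  simp_rw [← pow_mul]
  constructor
  · rintro ⟨n, -, h⟩
    exact ⟨n, Nat.pow_right_injective (two_le_rr hr hm0 hm i) h⟩
  · rintro ⟨n, rfl⟩
    exact ⟨n, Nat.pos_of_mul_pos_left hs, rfl⟩

theorem powerCount_Ico_eq_zero (hr : 2 ≤ r) (hm0 : m 0 = 1) (hm : ∀ j, 1 ≤ j → 2 ≤ m j)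
    {i B k N : ℕ} (h1 : rr r m i ^ N < k) (h2 : k < rr r m i ^ (N + 2))
    (h3 : k ≠ rr r m i ^ (N + 1)) : powerCount r m (Finset.Ico i B) k = 0 := by
  rw [powerCount, Finset.card_eq_zero, Finset.filter_eq_empty_iff]
  rintro l hl ⟨n, hn, rfl⟩
  rw [rr_eq_rr_pow (Finset.mem_Ico.1 hl).1, ← pow_mul] at h1 h2 h3
  have h1' := (Nat.pow_lt_pow_iff_right (two_le_rr hr hm0 hm i)).1 h1
  have h2' := (Nat.pow_lt_pow_iff_right (two_le_rr hr hm0 hm i)).1 h2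
  exact h3 (by congr 1; omega)

theorem powerCount_Ico_mul (hr : 2 ≤ r) (hm0 : m 0 = 1) (hm : ∀ j, 1 ≤ j → 2 ≤ m j)
    {i b B t : ℕ} (hib : i ≤ b) (hB : b < B) (ht : 0 < t) (hmt : ¬ m (b + 1) ∣ t) :
    powerCount r m (Finset.Ico i B)
      (rr r m i ^ ((∏ x ∈ Finset.Ico (i + 1) (b + 1), m x) * t)) = b + 1 - i := by
  have hpos := prod_Ico_pos hm i (b + 1)
  rw [powerCount, ← Nat.card_Ico]
  congr 1
  ext l
  simp only [Finset.mem_filter, Finset.mem_Ico]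
  constructor
  · rintro ⟨⟨h1, h2⟩, h3⟩
    rw [exists_pow_eq_iff_dvd hr hm0 hm h1 (by positivity)] at h3
    refine ⟨h1, ?_⟩
    by_contra! h
    rw [← Finset.prod_Ico_consecutive _ (by omega : i + 1 ≤ b + 1) (by omega : b + 1 ≤ l + 1)]
      at h3
    exact hmt ((Finset.dvd_prod_of_mem m (by rw [Finset.mem_Ico]; omega)).trans
      (Nat.dvd_of_mul_dvd_mul_left hpos h3))
  · rintro ⟨h1, h2⟩
    refine ⟨⟨h1, by omega⟩, ?_⟩
    rw [exists_pow_eq_iff_dvd hr hm0 hm h1 (by positivity),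
      ← Finset.prod_Ico_consecutive _ (by omega : i + 1 ≤ l + 1) (by omega : l + 1 ≤ b + 1),
      mul_assoc]
    exact dvd_mul_right _ _

theorem exists_approximant {p : ℕ} (hp : p.Prime) (Fq : Type) [Field Fq] [CharP Fq p]
    (hr : 2 ≤ r) (hm0 : m 0 = 1) (hm : ∀ j, 1 ≤ j → 2 ≤ m j) {j e N t : ℕ}
    (hd : rr r m j = p ^ e) (ht : 0 < t) (hmt : ¬ m (j + p + 1) ∣ t)
    (hN : N + 1 = (∏ x ∈ Finset.Ico (j + 2) (j + p + 1), m x) * t) (q : ℕ) :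
    ∃ (β : LaurentSeries Fq) (A : Fq[X]), A.natDegree ≤ p ^ e * rr r m (j + 1) ^ N ∧
      HahnSeries.single (-((p ^ e * rr r m (j + 1) ^ N : ℕ) : ℤ)) 1 * (β ^ p ^ e - β) =
        ringHomT Fq A ∧
      absL Fq q (xi Fq r m - β) = (q : ℝ) ^ (-((rr r m (j + 1) ^ (N + 2) : ℕ) : ℤ)) := by
  have : Fact p.Prime := ⟨hp⟩
  have hp2 := hp.two_le
  set R := rr r m (j + 1) with hR
  have hR2 : 2 ≤ R := two_le_rr hr hm0 hm _
  have hRN : 0 < R ^ N := by positivity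
  set f : ℕ → ℕ := fun k => if k ≤ R ^ N then powerCount r m (Finset.range k) k else
    powerCount r m (Finset.range (j + 1)) k with hf
  obtain ⟨A, hA, hA'⟩ := exists_ringHomT_eq_of_eventually (Fq := Fq) (p := p) (f := f) (e := e)
    (D := p ^ e * R ^ N) fun k hk => by
      have h1 : R ^ N < k := lt_of_le_of_lt (Nat.le_mul_of_pos_left _ (by
        have := hp.pos
        positivity)) hk
      have h2 : p ^ e < k := lt_of_le_of_lt (Nat.le_mul_of_pos_right _ hRN) hk
      rw [← hd] at h2 hk ⊢
      rw [hf]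
      simp only [if_neg h1.not_ge]
      rw [← powerCount_mul_eq hr hm0 hm j h2]
      split_ifs with h3 h4
      · obtain ⟨l, rfl⟩ := h3
        rw [Nat.mul_div_cancel_left _ (zero_lt_two.trans_le (two_le_rr hr hm0 hm j))] at h4
        exact absurd (Nat.mul_le_mul_left _ h4) hk.not_ge
      · rfl
      · rfl
  refine ⟨natSeries Fq f, A, hA, hA', ?_⟩
  have hlarge {k : ℕ} (hk : R ^ N < k) (B : ℕ) (hB : k ≤ B) (hj : j + 1 ≤ B) :
      powerCount r m (Finset.range k) k = f k + powerCount r m (Finset.Ico (j + 1) B) k := by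
    rw [hf]
    simp only [if_neg hk.not_ge]
    exact powerCount_eq_add_Ico hr hm0 hm hB hj
  rw [xi_eq_natSeries hr hm0 hm]
  refine absL_natSeries_sub (fun k hk => ?_) ?_ q
  · by_cases hkN : k ≤ R ^ N
    · simp [hf, hkN]
    · push Not at hkN
      rw [hlarge hkN (k + j + p + 2) (by omega) (by omega)]
      by_cases hk1 : k = R ^ (N + 1)
      · rw [hk1, hN, hR, powerCount_Ico_mul hr hm0 hm (by omega : j + 1 ≤ j + p) (by omega) ht hmt,
          show j + p + 1 - (j + 1) = p by omega]
        simp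
      · rw [powerCount_Ico_eq_zero hr hm0 hm hkN hk hk1, add_zero]
  · have hlt : R ^ N < R ^ (N + 2) := Nat.pow_lt_pow_right hR2 (by omega)
    rw [hlarge hlt (R ^ (N + 2) + j + 2) (by omega) (by omega)]
    have hcount := powerCount_Ico_mul hr hm0 hm (le_refl (j + 1)) (B := R ^ (N + 2) + j + 2)
      (by omega) (by omega : 0 < N + 2) (fun hdvd => by
        have h1 : m (j + 2) ∣ N + 1 := by
          rw [hN]
          exact (Finset.dvd_prod_of_mem m (by rw [Finset.mem_Ico]; omega)).mul_right _
        have h2 := (Nat.dvd_add_right (c := 1) h1).1 hdvd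
        have h3 := Nat.le_of_dvd one_pos h2
        have h4 := hm (j + 2) (by omega)
        omega)
    rw [Finset.Ico_self, Finset.prod_empty, one_mul, ← hR] at hcount
    rw [hcount]
    simp

end Exponents

section Bounds

variable {r : ℕ} {m : ℕ → ℕ}

theorem rr_lt_rr_succ (hr : 2 ≤ r) (hm0 : m 0 = 1) (hm : ∀ j, 1 ≤ j → 2 ≤ m j) (j : ℕ) :
    rr r m j < rr r m (j + 1) := by
  have h := two_le_rr hr hm0 hm j
  rw [rr_eq_rr_pow (Nat.le_succ j), Nat.succ_eq_add_one, Nat.Ico_succ_singleton,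
    Finset.prod_singleton]
  exact lt_self_pow₀ (by omega) (hm (j + 1) (by omega))

theorem le_wnStar_xi {p : ℕ} (hp : p.Prime) (Fq : Type) [Field Fq] [CharP Fq p]
    {q : ℕ} (hq : 1 < q) (hr : 2 ≤ r) (hm0 : m 0 = 1) (hm : ∀ j, 1 ≤ j → 2 ≤ m j) {j e : ℕ}
    (he : 0 < e) (hd : rr r m j = p ^ e) :
    (((rr r m (j + 1) : ℝ) ^ 2 / (rr r m j : ℝ) - 1 : ℝ) : EReal)
      ≤ wnStar Fq q (rr r m j) (xi Fq r m) := by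
  have : Fact p.Prime := ⟨hp⟩
  obtain ⟨V, hV, hext, habs⟩ := exists_absoluteValue_eq_absC Fq q hq
  have hq1 : (1 : ℝ) < q := by exact_mod_cast hq
  refine le_sSup (mem_image_of_mem _ ?_)
  rw [mem_ofPred_eq]
  set M := ∏ x ∈ Finset.Ico (j + 2) (j + p + 1), m x with hM
  have hMpos : 0 < M := prod_Ico_pos hm (j + 1) (j + p + 1)
  set R := rr r m (j + 1) with hR
  have hR2 : 2 ≤ R := two_le_rr hr hm0 hm _
  have hd2 : 2 ≤ rr r m j := two_le_rr hr hm0 hm _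
  have hm' := hm (j + p + 1) (by omega)
  have key (k : ℕ) := exists_approximant hp Fq hr hm0 hm (N := M * (1 + k * m (j + p + 1)) - 1)
    (t := 1 + k * m (j + p + 1)) hd (by omega)
    (fun h => by
      have := Nat.le_of_dvd one_pos ((Nat.dvd_add_left (dvd_mul_left _ k)).1 h)
      omega)
    (Nat.sub_add_cancel (Nat.mul_pos hMpos (by omega))) q
  choose β A hA hβ hξ using key
  refine infinite_of_injective_forall_mem (f := fun k => iota Fq (β k)) (fun k l hkl => ?_)
    fun k => ?_
  · have h := hξ k
    rw [(iota Fq).injective hkl, hξ l] at h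
    have h1 := zpow_right_injective₀ (by positivity) hq1.ne' h
    have h2 := Nat.pow_right_injective hR2 (Int.ofNat_injective (neg_injective h1))
    have h3 : 0 < M * (1 + k * m (j + p + 1)) := by positivity
    have h4 : 0 < M * (1 + l * m (j + p + 1)) := by positivity
    have h5 : M * (1 + l * m (j + p + 1)) = M * (1 + k * m (j + p + 1)) := by omega
    have h6 := Nat.eq_of_mul_eq_mul_left hMpos h5
    exact (Nat.eq_of_mul_eq_mul_right (by omega : 0 < m (j + p + 1)) (by omega)).symm
  · obtain ⟨halg, hmin⟩ := isAlgT_and_degree_le_of_additive hq hV hext he (hA k) (hβ k)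
    obtain ⟨P, hP, hdeg, hheight⟩ := exists_isMinPolyOf halg q
    have hPle := hmin P hP
    have hξV : absC Fq q (iota Fq (xi Fq r m) - iota Fq (β k)) =
        (q : ℝ) ^ (-((R ^ (M * (1 + k * m (j + p + 1)) - 1 + 2) : ℕ) : ℤ)) := by
      rw [habs, ← map_sub, hext, hξ k]
    refine ⟨halg, by rw [hdeg, hd]; exact hPle.1, ?_, ?_⟩
    · rw [hξV]
      positivity
    · rw [hξV, hheight, ← Real.rpow_natCast, ← Real.rpow_mul (by positivity),
        ← Real.rpow_intCast]
      refine Real.rpow_le_rpow_of_exponent_le hq1.le ?_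
      set N := M * (1 + k * m (j + p + 1)) - 1
      have hd0 : (0 : ℝ) < rr r m j := by exact_mod_cast (by omega : 0 < rr r m j)
      have h1 : (logHeight P : ℝ) ≤ rr r m j * (R : ℝ) ^ N := by
        rw [hd]
        exact_mod_cast hPle.2
      have h2 : (logHeight P : ℝ) * ((R : ℝ) ^ 2 / rr r m j) ≤ (R : ℝ) ^ (N + 2) := by
        calc _ ≤ rr r m j * (R : ℝ) ^ N * ((R : ℝ) ^ 2 / rr r m j) := by gcongr
          _ = (R : ℝ) ^ (N + 2) := by
            rw [pow_add]
            field_simp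
      push_cast
      linarith

theorem exists_scale {R L d : ℕ} (hR : 2 ≤ R) (hL : 0 < L) (hdR : d < R) {u : ℕ} (hu : 2 ≤ u)
    {h : ℕ} (hh : R ^ (L - 1) * (R ^ 2 - d ^ 2) ≤ d * h) :
    ∃ N t, 0 < t ∧ ¬ u ∣ t ∧ N + 1 = L * t ∧ d * h < R ^ N * (R ^ 2 - d ^ 2) ∧
      R ^ N * (R ^ 2 - d ^ 2) ≤ (R ^ L) ^ 2 * (d * h) := by
  set E := R ^ 2 - d ^ 2 with hE
  have hEpos : 0 < E := Nat.sub_pos_of_lt (Nat.pow_lt_pow_left hdR (by norm_num))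
  have hlarge {s : ℕ} (hs : d * h < s) : d * h < R ^ (L * s - 1) * E := by
    have h1 : s ≤ L * s := Nat.le_mul_of_pos_left _ hL
    have h2 : L * s - 1 < R ^ (L * s - 1) := Nat.lt_pow_self (by omega)
    have h3 : R ^ (L * s - 1) ≤ R ^ (L * s - 1) * E := Nat.le_mul_of_pos_right _ hEpos
    omega
  set s := Nat.findGreatest (fun s => R ^ (L * s - 1) * E ≤ d * h) (d * h + 1) with hs
  have hs1 : R ^ (L * s - 1) * E ≤ d * h :=
    Nat.findGreatest_spec (P := fun s => R ^ (L * s - 1) * E ≤ d * h) (m := 1) (by omega)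
      (by simpa using hh)
  have hs0 : 1 ≤ s := Nat.le_findGreatest (by omega) (by simpa using hh)
  have hgt {t : ℕ} (ht : s < t) : d * h < R ^ (L * t - 1) * E := by
    by_cases htb : t ≤ d * h + 1
    · exact not_le.1 (Nat.findGreatest_is_greatest (P := fun s => R ^ (L * s - 1) * E ≤ d * h)
        ht htb)
    · exact hlarge (by omega)
  have hmain {t : ℕ} (ht : s < t) (ht2 : t ≤ s + 2) (hut : ¬ u ∣ t) :
      ∃ N t, 0 < t ∧ ¬ u ∣ t ∧ N + 1 = L * t ∧ d * h < R ^ N * E ∧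
        R ^ N * E ≤ (R ^ L) ^ 2 * (d * h) := by
    have hLt : 0 < L * t := Nat.mul_pos hL (by omega)
    have hLs : 0 < L * s := Nat.mul_pos hL (by omega)
    refine ⟨L * t - 1, t, by omega, hut, Nat.sub_add_cancel hLt, hgt ht, ?_⟩
    have h1 : L * t ≤ L * (s + 2) := Nat.mul_le_mul_left _ ht2
    calc R ^ (L * t - 1) * E ≤ R ^ (L * 2 + (L * s - 1)) * E := by
          refine Nat.mul_le_mul_right _ (Nat.pow_le_pow_right (by omega) ?_)
          rw [mul_add] at h1
          omega
      _ = (R ^ L) ^ 2 * (R ^ (L * s - 1) * E) := by rw [pow_add, pow_mul, mul_assoc]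
      _ ≤ _ := Nat.mul_le_mul_left _ hs1
  by_cases hus : u ∣ s + 1
  · refine hmain (t := s + 2) (by omega) le_rfl fun h2 => ?_
    have := Nat.le_of_dvd one_pos ((Nat.dvd_add_right (c := 1) hus).1 h2)
    omega
  · exact hmain (t := s + 1) (by omega) (by omega) hus

theorem wnStar_xi_le {p : ℕ} (hp : p.Prime) (Fq : Type) [Field Fq] [Finite Fq] [CharP Fq p]
    {q : ℕ} (hq : 1 < q) (hr : 2 ≤ r) (hm0 : m 0 = 1) (hm : ∀ j, 1 ≤ j → 2 ≤ m j) {j e : ℕ}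
    (he : 0 < e) (hd : rr r m j = p ^ e) :
    wnStar Fq q (rr r m j) (xi Fq r m)
      ≤ (((rr r m j : ℝ) * (rr r m (j + 1) : ℝ) ^ 2 * (rr r m (j + p) : ℝ) ^ 2 /
          ((rr r m (j + 1) : ℝ) ^ 2 - (rr r m j : ℝ) ^ 2) - 1 : ℝ) : EReal) := by
  have : Fact p.Prime := ⟨hp⟩
  obtain ⟨V, hV, hext, habs⟩ := exists_absoluteValue_eq_absC Fq q hq
  have hq1 : (1 : ℝ) < q := by exact_mod_cast hq
  set M := ∏ x ∈ Finset.Ico (j + 2) (j + p + 1), m x with hM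
  have hMpos : 0 < M := prod_Ico_pos hm (j + 1) (j + p + 1)
  have hRM : rr r m (j + p) = rr r m (j + 1) ^ M :=
    rr_eq_rr_pow (by have := hp.two_le; omega)
  have hdR := rr_lt_rr_succ hr hm0 hm j
  set R := rr r m (j + 1) with hR
  set d := rr r m j with hdd
  have hR2 : 2 ≤ R := two_le_rr hr hm0 hm _
  have hd2 : 2 ≤ d := two_le_rr hr hm0 hm _
  refine sSup_le ?_
  rintro _ ⟨w, hw, rfl⟩
  rw [mem_ofPred_eq] at hw
  rw [EReal.coe_le_coe_iff]
  obtain ⟨α, ⟨halg, hdeg, -, hle⟩, hα⟩ :=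
    hw.exists_notMem_finite (finite_setOf_degree_le_logHeight_le d (R ^ (M - 1) * (R ^ 2 - d ^ 2)))
  obtain ⟨P, hP, hPdeg, hheight⟩ := exists_isMinPolyOf halg q
  rw [hPdeg] at hdeg
  have hlarge : R ^ (M - 1) * (R ^ 2 - d ^ 2) < logHeight P := by
    by_contra! h
    exact hα ⟨P, hP, hdeg, h⟩
  obtain ⟨N, t, ht, hmt, hN, hN1, hN2⟩ := exists_scale hR2 hMpos hdR
    (hm (j + p + 1) (by omega)) (hlarge.le.trans (Nat.le_mul_of_pos_left _ (by omega : 0 < d)))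
  obtain ⟨β, A, hA, hβ, hξ⟩ := exists_approximant hp Fq hr hm0 hm hd ht hmt hN q
  rw [← hR] at hA hβ hξ
  have hsq : d ^ 2 ≤ R ^ 2 := Nat.pow_le_pow_left hdR.le 2
  have hlow : (q : ℝ) ^ (-((R ^ (N + 2) : ℕ) : ℤ)) ≤ V (iota Fq (xi Fq r m) - α) := by
    by_cases hαβ : α = iota Fq β
    · rw [hαβ, ← map_sub, hext, hξ]
    · have hliou := le_map_sub_of_additive hq hV hext he hA hβ hP (hdeg.trans hd.le) hαβ
      have hexp : p ^ e * logHeight P + p ^ e * (p ^ e * R ^ N) < R ^ (N + 2) := by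
        rw [← hd]
        zify [hsq] at hN1 ⊢
        have : (R : ℤ) ^ (N + 2) = R ^ N * (R ^ 2 - d ^ 2) + d * (d * R ^ N) := by ring
        rw [this]
        linarith
      have hlt : (q : ℝ) ^ (-((R ^ (N + 2) : ℕ) : ℤ)) < V (α - iota Fq β) := by
        rw [zpow_neg, zpow_natCast, inv_lt_iff_one_lt_mul₀ (by positivity)]
        exact hliou.trans_lt (mul_lt_mul_of_pos_left (pow_lt_pow_right₀ hq1 hexp)
          (V.pos (sub_ne_zero.2 hαβ)))
      have hult := hV (α - iota Fq (xi Fq r m)) (iota Fq (xi Fq r m) - iota Fq β)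
      rw [sub_add_sub_cancel, ← map_sub, hext, hξ, V.map_sub α (iota Fq (xi Fq r m))] at hult
      rcases le_max_iff.1 hult with h | h
      · exact hlt.le.trans h
      · exact absurd h hlt.not_ge
  rw [habs, hheight] at hle
  have hcomp := hlow.trans hle
  rw [← Real.rpow_natCast, ← Real.rpow_mul (by positivity), ← Real.rpow_intCast,
    Real.rpow_le_rpow_left_iff hq1] at hcomp
  have hh : (0 : ℝ) < logHeight P := by exact_mod_cast (by omega : 0 < logHeight P)
  have hdR' : (d : ℝ) < R := by exact_mod_cast hdR
  have hE : (0 : ℝ) < (R : ℝ) ^ 2 - (d : ℝ) ^ 2 := by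
    have : (d : ℝ) ^ 2 < (R : ℝ) ^ 2 := by gcongr
    linarith
  have hN2' : (R : ℝ) ^ N * ((R : ℝ) ^ 2 - (d : ℝ) ^ 2) ≤
      ((R : ℝ) ^ M) ^ 2 * (d * logHeight P) := by
    have := (Nat.cast_le (α := ℝ)).2 hN2
    push_cast [Nat.cast_sub hsq] at this
    exact this
  rw [le_sub_iff_add_le, le_div_iff₀ hE, hRM]
  push_cast at hcomp ⊢
  refine le_of_mul_le_mul_right ?_ hh
  calc (w + 1) * ((R : ℝ) ^ 2 - (d : ℝ) ^ 2) * logHeight P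
      = (logHeight P * (w + 1)) * ((R : ℝ) ^ 2 - (d : ℝ) ^ 2) := by ring
    _ ≤ (R : ℝ) ^ (N + 2) * ((R : ℝ) ^ 2 - (d : ℝ) ^ 2) := by
        gcongr
        linarith
    _ = (R : ℝ) ^ 2 * ((R : ℝ) ^ N * ((R : ℝ) ^ 2 - (d : ℝ) ^ 2)) := by ring
    _ ≤ (R : ℝ) ^ 2 * (((R : ℝ) ^ M) ^ 2 * (d * logHeight P)) := by gcongr
    _ = _ := by ring

end Bounds

/-- For every `j ≥ 0`,
`r_{j+1}²/r_j − 1 ≤ w_{r_j}^*(ξ(r,m)) ≤ r_j r_{j+1}² r_{j+p}²/(r_{j+1}² − r_j²) − 1`. -/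
theorem wnStar_xi_bounds (p : ℕ) (hp : p.Prime) (q : ℕ) (hq : ∃ e : ℕ, 0 < e ∧ q = p ^ e)
    (Fq : Type) [Field Fq] [Fintype Fq] [CharP Fq p] (hcard : Fintype.card Fq = q)
    (r : ℕ) (hr : ∃ e : ℕ, 0 < e ∧ r = p ^ e)
    (m : ℕ → ℕ) (hm0 : m 0 = 1) (hm : ∀ j : ℕ, 1 ≤ j → 2 ≤ m j) :
    ∀ j : ℕ,
      (((rr r m (j + 1) : ℝ) ^ 2 / (rr r m j : ℝ) - 1 : ℝ) : EReal)
          ≤ wnStar Fq q (rr r m j) (xi Fq r m) ∧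
        wnStar Fq q (rr r m j) (xi Fq r m)
          ≤ (((rr r m j : ℝ) * (rr r m (j + 1) : ℝ) ^ 2 * (rr r m (j + p) : ℝ) ^ 2 /
              ((rr r m (j + 1) : ℝ) ^ 2 - (rr r m j : ℝ) ^ 2) - 1 : ℝ) : EReal) := by
  intro j
  have hr2 : 2 ≤ r := by
    obtain ⟨e, he, rfl⟩ := hr
    exact Nat.succ_le_of_lt (one_lt_pow₀ hp.one_lt he.ne')
  have hq1 : 1 < q := by
    obtain ⟨e, he, rfl⟩ := hq
    exact one_lt_pow₀ hp.one_lt he.ne'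
  obtain ⟨e, he, hd⟩ : ∃ e, 0 < e ∧ rr r m j = p ^ e := by
    obtain ⟨e, he, rfl⟩ := hr
    refine ⟨e * ∏ i ∈ Finset.range (j + 1), m i, Nat.mul_pos he (Finset.prod_pos fun i _ => ?_),
      by rw [rr, pow_mul]⟩
    rcases Nat.eq_zero_or_pos i with rfl | hi
    · omega
    · have := hm i hi
      omega
  exact ⟨le_wnStar_xi hp Fq hq1 hr2 hm0 hm he hd, wnStar_xi_le hp Fq hq1 hr2 hm0 hm he hd⟩
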